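/- Fix an integer r, an entire function F : ℂ → ℂ that does not vanish on ℂ \ {0}, a function W : (0,∞) → ℝ with W(w) − w = O(w²) as w → 0⁺, and a compact set S ⊂ ℂ. For τ ∈ ℂ and w > 0 set z(τ, w) = (1 − τ·w^{2/3})/(e·w). Then there is a function η : ℂ × (0,∞) → ℂ such that for all small w > 0 and all τ ∈ S: φ_r(z(τ,w), w, W(w); F) = (−1)^r · √(2π) · 2^{(r+1)/3} · w^{r/3 − 1/6} · (Ai(r; 2^{1/3}·τ)·F(1) + η(τ, w)) · exp(−1/(2w) + τ/w^{1/3}), and sup_{τ ∈ S} ‖η(τ, w)‖ → 0 as w → 0⁺. (This is the uniform version on compact τ-sets of the asymptotics φ_r ∼ (−1)^r √(2π) 2^{(r+1)/3} w^{r/3−1/6} Ai(r; 2^{1/3}τ) exp(−1/(2w) + τ/w^{1/3}) F(1).) -/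

import Mathlib

open Filter Topology

/-- The contour `Π(φ)`. -/
noncomputable def airyPath (φ : ℝ) (s : ℝ) : ℂ :=
  if s ≤ -1 then -Complex.exp (-(φ : ℂ) * Complex.I) * (s : ℂ)
  else if s ≤ 1 then (Real.cos φ : ℂ) + Complex.I * (s : ℂ) * (Real.sin φ : ℂ)
  else Complex.exp ((φ : ℂ) * Complex.I) * (s : ℂ)

/-- The piecewise derivative of the contour `Π(φ)`. -/
noncomputable def airyPathDeriv (φ : ℝ) (s : ℝ) : ℂ :=
  if s ≤ -1 then -Complex.exp (-(φ : ℂ) * Complex.I)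
  else if s ≤ 1 then Complex.I * (Real.sin φ : ℂ)
  else Complex.exp ((φ : ℂ) * Complex.I)

/-- The generalised Airy function `Ai(k; z)`. -/
noncomputable def genAiry (k : ℤ) (z : ℂ) : ℂ :=
  ((-1 : ℂ) ^ k / (2 * (Real.pi : ℂ) * Complex.I)) *
    ∫ s : ℝ, (airyPath (Real.pi / 3) s) ^ k *
      Complex.exp (-z * airyPath (Real.pi / 3) s + (airyPath (Real.pi / 3) s) ^ 3 / 3) *
      airyPathDeriv (Real.pi / 3) s

/-- `φ_r(z, w, w⁺; F)`. -/
noncomputable def phiR (r : ℤ) (z : ℂ) (w wp : ℝ) (F : ℂ → ℂ) : ℂ :=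
  (1 / (Real.sqrt (2 * Real.pi * w) : ℂ)) *
    ∫ x : ℝ, (1 - z * (wp : ℂ) * Complex.exp (-Complex.I * (x : ℂ))) ^ r *
      Complex.exp (-(x : ℂ) ^ 2 / (2 * (w : ℂ)) - z * Complex.exp (-Complex.I * (x : ℂ))) *
      F (z * (wp : ℂ) * Complex.exp (-Complex.I * (x : ℂ)))

open MeasureTheory

/-- Two paths in a convex open set give the same integral of a holomorphic function, provided that
the function is small on the segments joining the far parts of the paths. -/
theorem integral_path_eq_of_convex {U : Set ℂ} (hU : IsOpen U) (hUc : Convex ℝ U)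
    {g : ℂ → ℂ} (hg : DifferentiableOn ℂ g U) {γ₀ γ₁ γ₀' γ₁' : ℝ → ℂ} {s : Set ℝ}
    (hs : s.Countable) (hγ₀ : Continuous γ₀) (hγ₁ : Continuous γ₁)
    (hγ₀U : ∀ t, γ₀ t ∈ U) (hγ₁U : ∀ t, γ₁ t ∈ U)
    (hγ₀' : ∀ t ∉ s, HasDerivAt γ₀ (γ₀' t) t) (hγ₁' : ∀ t ∉ s, HasDerivAt γ₁ (γ₁' t) t)
    (hi₀ : Integrable fun t => g (γ₀ t) * γ₀' t) (hi₁ : Integrable fun t => g (γ₁ t) * γ₁' t)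
    {b : ℝ → ℝ}
    (hb : ∀ t, ∀ p ∈ segment ℝ (γ₀ t) (γ₁ t), ‖g p‖ * ‖γ₁ t - γ₀ t‖ ≤ b t)
    (hb_top : Tendsto b atTop (𝓝 0)) (hb_bot : Tendsto b atBot (𝓝 0)) :
    ∫ t, g (γ₀ t) * γ₀' t = ∫ t, g (γ₁ t) * γ₁' t := by
  obtain ⟨G, hG⟩ := hUc.exists_forall_hasDerivWithinAt hg
  have hG' : ∀ z ∈ U, HasDerivAt G (g z) z := fun z hz =>
    (hG z hz).hasDerivAt (hU.mem_nhds hz)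
  have ftc : ∀ {γ γ' : ℝ → ℂ}, Continuous γ → (∀ t, γ t ∈ U) →
      (∀ t ∉ s, HasDerivAt γ (γ' t) t) → Integrable (fun t => g (γ t) * γ' t) → ∀ R : ℝ,
      ∫ t in (-R)..R, g (γ t) * γ' t = G (γ R) - G (γ (-R)) := by
    intro γ γ' hc hin hd hi R
    refine integral_eq_of_hasDerivAt_off_countable (fun t => G (γ t)) _ hs ?_ ?_
      hi.intervalIntegrable
    · refine Continuous.continuousOn (continuous_iff_continuousAt.2 fun t => ?_)
      exact (hG' _ (hin t)).continuousAt.comp hc.continuousAt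
    · intro t ht
      exact (hG' _ (hin t)).comp t (hd t ht.2)
  have hdiff : ∀ t, ‖G (γ₁ t) - G (γ₀ t)‖ ≤ b t := by
    intro t
    by_cases h0 : γ₁ t = γ₀ t
    · have := hb t (γ₀ t) (left_mem_segment ℝ _ _)
      simpa [h0] using this
    · have hpos : 0 < ‖γ₁ t - γ₀ t‖ := norm_pos_iff.2 (sub_ne_zero.2 h0)
      have hseg : segment ℝ (γ₀ t) (γ₁ t) ⊆ U := hUc.segment_subset (hγ₀U t) (hγ₁U t)
      have := Convex.norm_image_sub_le_of_norm_hasDerivWithin_le (C := b t / ‖γ₁ t - γ₀ t‖)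
        (fun p hp => (hG' p (hseg hp)).hasDerivWithinAt)
        (fun p hp => by rw [le_div_iff₀ hpos]; exact hb t p hp)
        (convex_segment (γ₀ t) (γ₁ t)) (left_mem_segment ℝ _ _) (right_mem_segment ℝ _ _)
      rwa [div_mul_cancel₀ _ hpos.ne'] at this
  have lim₀ := intervalIntegral_tendsto_integral hi₀ tendsto_neg_atTop_atBot
    (tendsto_id (x := atTop (α := ℝ)))
  have lim₁ := intervalIntegral_tendsto_integral hi₁ tendsto_neg_atTop_atBot
    (tendsto_id (x := atTop (α := ℝ)))
  have hlim : Tendsto (fun R => b R + b (-R)) atTop (𝓝 0) := by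
    simpa using hb_top.add (hb_bot.comp tendsto_neg_atTop_atBot)
  have hz : Tendsto (fun R : ℝ => (∫ t in (-R)..R, g (γ₁ t) * γ₁' t) -
      ∫ t in (-R)..R, g (γ₀ t) * γ₀' t) atTop (𝓝 0) := by
    refine squeeze_zero_norm (fun R => ?_) hlim
    rw [ftc hγ₀ hγ₀U hγ₀' hi₀, ftc hγ₁ hγ₁U hγ₁' hi₁]
    calc ‖G (γ₁ R) - G (γ₁ (-R)) - (G (γ₀ R) - G (γ₀ (-R)))‖
        = ‖(G (γ₁ R) - G (γ₀ R)) - (G (γ₁ (-R)) - G (γ₀ (-R)))‖ := by ring_nf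
      _ ≤ _ := (norm_sub_le _ _).trans (add_le_add (hdiff _) (hdiff _))
  exact (sub_eq_zero.1 (tendsto_nhds_unique (lim₁.sub lim₀) hz)).symm

theorem exists_pow_mul_exp_mul_gaussian_le (n : ℕ) (B : ℝ) {c : ℝ} (hc : 0 < c) :
    ∃ C, 0 ≤ C ∧ ∀ s : ℝ, (8 * (1 + |s|)) ^ n * Real.exp (B * (1 + |s|)) * Real.exp (-c * s ^ 2) ≤
      C * Real.exp (-(c / 2) * s ^ 2) := by
  refine ⟨n.factorial * Real.exp (|8 + B| + |8 + B| ^ 2 / (2 * c)), by positivity, fun s => ?_⟩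
  have h1 : (8 * (1 + |s|)) ^ n ≤ n.factorial * Real.exp (8 * (1 + |s|)) := by
    have := Real.pow_div_factorial_le_exp (8 * (1 + |s|)) (by positivity) n
    rwa [div_le_iff₀' (by positivity)] at this
  calc _ ≤ n.factorial * Real.exp (8 * (1 + |s|)) * Real.exp (B * (1 + |s|)) *
        Real.exp (-c * s ^ 2) := by gcongr
    _ = n.factorial * Real.exp ((8 + B) * (1 + |s|) - c * s ^ 2) := by
        rw [mul_assoc, mul_assoc, ← Real.exp_add, ← Real.exp_add]; ring_nf
    _ ≤ n.factorial * Real.exp (|8 + B| + |8 + B| ^ 2 / (2 * c) + -(c / 2) * s ^ 2) := by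
        gcongr
        have h2 : (8 + B) * (1 + |s|) ≤ |8 + B| * (1 + |s|) := by gcongr; exact le_abs_self _
        have h3 : |8 + B| * |s| ≤ |8 + B| ^ 2 / (2 * c) + c / 2 * s ^ 2 := by
          rw [← sq_abs s, ← sub_nonneg]
          have : |8 + B| ^ 2 / (2 * c) + c / 2 * |s| ^ 2 - |8 + B| * |s| =
            (|8 + B| - c * |s|) ^ 2 / (2 * c) := by field_simp; ring
          rw [this]; positivity
        nlinarith
    _ = _ := by rw [Real.exp_add]; ring

theorem norm_zpow_le_pow_natAbs {q : ℂ} (r : ℤ) {M : ℝ} (h1 : ‖q‖ ≤ M) (h2 : ‖q‖⁻¹ ≤ M) :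
    ‖q ^ r‖ ≤ M ^ r.natAbs := by
  rw [norm_zpow]
  rcases Int.natAbs_eq r with h | h
  · conv_lhs => rw [h]
    rw [zpow_natCast]
    gcongr
  · conv_lhs => rw [h]
    rw [zpow_neg, zpow_natCast, ← inv_pow]
    gcongr

theorem tendsto_const_mul_gaussian (C : ℝ) {c : ℝ} (hc : 0 < c) {l : Filter ℝ}
    (hl : Tendsto (fun t : ℝ => |t|) l atTop) :
    Tendsto (fun t : ℝ => C * Real.exp (-c * t ^ 2)) l (𝓝 0) := by
  have hl2 : Tendsto (fun t : ℝ => t ^ 2) l atTop := by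
    simpa [Function.comp_def] using (tendsto_pow_atTop two_ne_zero).comp hl
  have h := (Real.tendsto_exp_atBot.comp
    (tendsto_neg_atTop_atBot.comp (hl2.const_mul_atTop hc))).const_mul C
  simpa [Function.comp_def] using h

/-- The vertical line `Re p = 1/2`. -/
noncomputable def airyLine (s : ℝ) : ℂ := ((1 / 2 : ℝ) : ℂ) + Complex.I * ((√3 / 2 * s : ℝ) : ℂ)

/-- The integrand of the generalised Airy function. -/
noncomputable def airyIntegrand (k : ℤ) (z p : ℂ) : ℂ := p ^ k * Complex.exp (-z * p + p ^ 3 / 3)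

theorem airyLine_re (s : ℝ) : (airyLine s).re = 1 / 2 := by simp [airyLine]

theorem airyLine_im (s : ℝ) : (airyLine s).im = √3 / 2 * s := by simp [airyLine]

theorem continuous_airyLine : Continuous airyLine := by unfold airyLine; fun_prop

theorem airyLine_ne_zero (s : ℝ) : airyLine s ≠ 0 := fun h => by
  have := congrArg Complex.re h
  rw [airyLine_re] at this
  norm_num at this

theorem sqrt_three_div_two_le_one : √3 / 2 ≤ 1 := by
  have : √3 ≤ 2 := Real.sqrt_le_iff.2 (by norm_num)
  linarith

theorem norm_add_I_mul_le {x : ℝ} (s : ℝ) (hx : 0 ≤ x) :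
    ‖(x : ℂ) + Complex.I * ((√3 / 2 * s : ℝ) : ℂ)‖ ≤ x + |s| := by
  refine (norm_add_le _ _).trans ?_
  rw [norm_mul, Complex.norm_I, one_mul, Complex.norm_real, Complex.norm_real, Real.norm_eq_abs,
    Real.norm_eq_abs, abs_of_nonneg hx, abs_mul, abs_of_nonneg (by positivity : (0 : ℝ) ≤ √3 / 2)]
  nlinarith [sqrt_three_div_two_le_one, abs_nonneg s]

theorem norm_airyLine_le (s : ℝ) : ‖airyLine s‖ ≤ 1 / 2 + |s| :=
  norm_add_I_mul_le s (by norm_num)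

theorem cube_re_le {x s : ℝ} (hx : 1 / 2 ≤ x) (hx' : x ≤ max (1 / 2) (|s| / 2)) :
    (((x : ℂ) + Complex.I * ((√3 / 2 * s : ℝ) : ℂ)) ^ 3 / 3).re ≤ 1 - s ^ 2 / 3 := by
  have h3 : √3 ^ 2 = 3 := Real.sq_sqrt (by norm_num)
  have key : (((x : ℂ) + Complex.I * ((√3 / 2 * s : ℝ) : ℂ)) ^ 3 / 3).re =
      x * (x ^ 2 - 9 / 4 * s ^ 2) / 3 := by
    have : ((x : ℂ) + Complex.I * ((√3 / 2 * s : ℝ) : ℂ)) = ⟨x, √3 / 2 * s⟩ := by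
      apply Complex.ext <;> simp
    rw [this, show (3 : ℂ) = ((3 : ℝ) : ℂ) by norm_num, Complex.div_ofReal_re]
    simp only [pow_succ, pow_zero, one_mul, Complex.mul_re, Complex.mul_im]
    linear_combination (-(x * s ^ 2) / 4) * h3
  rw [key]
  rcases le_total |s| 1 with hs | hs
  · have hx2 : x = 1 / 2 := le_antisymm (by rwa [max_eq_left (by linarith)] at hx') hx
    subst hx2
    nlinarith [sq_nonneg s]
  · rw [max_eq_right (by linarith)] at hx'
    have hs2 : |s| ^ 2 = s ^ 2 := sq_abs s
    have : x ^ 2 - 9 / 4 * s ^ 2 ≤ -2 * s ^ 2 := by nlinarith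
    nlinarith [sq_nonneg s]

theorem exists_norm_airyIntegrand_le (k : ℤ) (Z : ℝ) :
    ∃ C, 0 ≤ C ∧ ∀ z : ℂ, ‖z‖ ≤ Z → ∀ x s : ℝ, 1 / 2 ≤ x → x ≤ max (1 / 2) (|s| / 2) →
      ‖airyIntegrand k z ((x : ℂ) + Complex.I * ((√3 / 2 * s : ℝ) : ℂ))‖ * (1 + |s|) ≤
        C * Real.exp (-(1 / 6) * s ^ 2) := by
  obtain ⟨C, hC0, hC⟩ := exists_pow_mul_exp_mul_gaussian_le (k.natAbs + 1) (2 * Z)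
    (by norm_num : (0 : ℝ) < 1 / 3)
  refine ⟨Real.exp 1 * C, by positivity, fun z hz x s hx hx' => ?_⟩
  set p : ℂ := (x : ℂ) + Complex.I * ((√3 / 2 * s : ℝ) : ℂ) with hp
  have hZ : 0 ≤ Z := (norm_nonneg z).trans hz
  have hs := abs_nonneg s
  have hxs : x ≤ 1 / 2 + |s| / 2 := hx'.trans (max_le (by linarith) (by linarith))
  have hpn : ‖p‖ ≤ 2 * (1 + |s|) := by
    have := norm_add_I_mul_le s (by linarith : 0 ≤ x)
    rw [← hp] at this
    linarith
  have hpre : p.re = x := by simp [hp]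
  have hpl : 1 / 2 ≤ ‖p‖ := by
    have := Complex.re_le_norm p
    linarith
  have hinv : ‖p‖⁻¹ ≤ 8 * (1 + |s|) := by
    rw [inv_le_comm₀ (by linarith) (by positivity), inv_le_comm₀ (by positivity) (by linarith)]
    have : ‖p‖⁻¹ ≤ (1 / 2)⁻¹ := inv_anti₀ (by norm_num) hpl
    norm_num at this
    linarith
  have h1 : ‖p ^ k‖ ≤ (8 * (1 + |s|)) ^ k.natAbs :=
    norm_zpow_le_pow_natAbs k (by linarith) hinv
  have h2 : ‖Complex.exp (-z * p + p ^ 3 / 3)‖ ≤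
      Real.exp (2 * Z * (1 + |s|) + (1 + -(1 / 3) * s ^ 2)) := by
    rw [Complex.norm_exp, Real.exp_le_exp, Complex.add_re]
    have h3 : (-z * p).re ≤ 2 * Z * (1 + |s|) := by
      refine (Complex.re_le_norm _).trans ?_
      rw [norm_mul, norm_neg]
      calc ‖z‖ * ‖p‖ ≤ Z * (2 * (1 + |s|)) := by gcongr
        _ = _ := by ring
    have h4 := cube_re_le hx hx'
    rw [← hp] at h4
    linarith
  calc ‖airyIntegrand k z p‖ * (1 + |s|)
      ≤ (8 * (1 + |s|)) ^ k.natAbs * Real.exp (2 * Z * (1 + |s|) + (1 + -(1 / 3) * s ^ 2)) *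
        (8 * (1 + |s|)) := by
        rw [airyIntegrand, norm_mul]
        gcongr
        linarith
    _ = Real.exp 1 * ((8 * (1 + |s|)) ^ (k.natAbs + 1) * Real.exp (2 * Z * (1 + |s|)) *
        Real.exp (-(1 / 3) * s ^ 2)) := by
        rw [Real.exp_add, Real.exp_add]; ring
    _ ≤ Real.exp 1 * (C * Real.exp (-(1 / 3 / 2) * s ^ 2)) := by
        exact mul_le_mul_of_nonneg_left (hC s) (Real.exp_pos 1).le
    _ = _ := by ring_nf

theorem exists_norm_airyIntegrand_airyLine_le (k : ℤ) (Z : ℝ) :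
    ∃ C, 0 ≤ C ∧ ∀ z : ℂ, ‖z‖ ≤ Z → ∀ s : ℝ,
      ‖airyIntegrand k z (airyLine s)‖ ≤ C * Real.exp (-(1 / 6) * s ^ 2) := by
  obtain ⟨C, hC0, hC⟩ := exists_norm_airyIntegrand_le k Z
  refine ⟨C, hC0, fun z hz s => le_trans ?_ (hC z hz (1 / 2) s le_rfl (le_max_left _ _))⟩
  exact le_mul_of_one_le_right (norm_nonneg _) (by linarith [abs_nonneg s])

theorem airyPath_pi_div_three (s : ℝ) : airyPath (Real.pi / 3) s =
    ((max (1 / 2) (|s| / 2) : ℝ) : ℂ) + Complex.I * ((√3 / 2 * s : ℝ) : ℂ) := by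
  have he : Complex.exp (((Real.pi / 3 : ℝ) : ℂ) * Complex.I) =
      (1 / 2 : ℂ) + ((√3 / 2 : ℝ) : ℂ) * Complex.I := by
    rw [Complex.exp_mul_I, ← Complex.ofReal_cos, ← Complex.ofReal_sin, Real.cos_pi_div_three,
      Real.sin_pi_div_three]
    push_cast; ring
  have he' : Complex.exp (-((Real.pi / 3 : ℝ) : ℂ) * Complex.I) =
      (1 / 2 : ℂ) - ((√3 / 2 : ℝ) : ℂ) * Complex.I := by
    rw [← Complex.ofReal_neg, Complex.exp_mul_I, ← Complex.ofReal_cos, ← Complex.ofReal_sin,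
      Real.cos_neg, Real.sin_neg, Real.cos_pi_div_three, Real.sin_pi_div_three]
    push_cast; ring
  unfold airyPath
  split_ifs with h1 h2
  · rw [he', abs_of_nonpos (by linarith), max_eq_right (by linarith)]
    push_cast; ring
  · rw [max_eq_left (by have := abs_le.2 ⟨(not_le.1 h1).le, h2⟩; linarith), Real.cos_pi_div_three,
      Real.sin_pi_div_three]
    push_cast; ring
  · rw [he, abs_of_pos (by linarith), max_eq_right (by linarith)]
    push_cast; ring

theorem hasDerivAt_airyPath (φ : ℝ) {s : ℝ} (hs : s ∉ ({-1, 1} : Set ℝ)) :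
    HasDerivAt (airyPath φ) (airyPathDeriv φ s) s := by
  have hs1 : s ≠ -1 := fun h => hs (by simp [h])
  have hs2 : s ≠ 1 := fun h => hs (by simp [h])
  have hid : HasDerivAt (fun t : ℝ => (t : ℂ)) 1 s := Complex.ofRealCLM.hasDerivAt
  unfold airyPathDeriv
  split_ifs with h1 h2
  · have hd := hid.const_mul (-Complex.exp (-(φ : ℂ) * Complex.I))
    rw [mul_one] at hd
    refine hd.congr_of_eventuallyEq ?_
    filter_upwards [Iio_mem_nhds (lt_of_le_of_ne h1 hs1)] with t ht
    simp [airyPath, (Set.mem_Iio.1 ht).le]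
  · have hd := ((hid.const_mul Complex.I).mul_const (Real.sin φ : ℂ)).const_add (Real.cos φ : ℂ)
    rw [mul_one] at hd
    refine hd.congr_of_eventuallyEq ?_
    filter_upwards [Ioo_mem_nhds (not_le.1 h1) (lt_of_le_of_ne h2 hs2)] with t ht
    simp [airyPath, ht.1.not_ge, ht.2.le]
  · have hd := hid.const_mul (Complex.exp ((φ : ℂ) * Complex.I))
    rw [mul_one] at hd
    refine hd.congr_of_eventuallyEq ?_
    filter_upwards [Ioi_mem_nhds (not_le.1 h2)] with t ht
    have ht' : 1 < t := ht
    simp [airyPath, ht'.not_ge, (by linarith : ¬ t ≤ -1)]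

theorem measurable_airyPathDeriv (φ : ℝ) : Measurable (airyPathDeriv φ) :=
  Measurable.ite measurableSet_Iic measurable_const
    (Measurable.ite measurableSet_Iic measurable_const measurable_const)

theorem norm_airyPathDeriv_le (φ s : ℝ) : ‖airyPathDeriv φ s‖ ≤ 1 := by
  unfold airyPathDeriv
  split_ifs
  · rw [norm_neg, ← Complex.ofReal_neg, Complex.norm_exp_ofReal_mul_I]
  · rw [norm_mul, Complex.norm_I, one_mul, Complex.norm_real]
    exact Real.abs_sin_le_one φ
  · rw [Complex.norm_exp_ofReal_mul_I]

theorem differentiableOn_airyIntegrand (k : ℤ) (z : ℂ) :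
    DifferentiableOn ℂ (airyIntegrand k z) {p | 0 < p.re} := by
  intro p hp
  have hp0 : p ≠ 0 := fun h => by simp [h] at hp
  have h1 : DifferentiableAt ℂ (fun p : ℂ => p ^ k) p := differentiableAt_zpow.2 (Or.inl hp0)
  have h2 : DifferentiableAt ℂ (fun p : ℂ => Complex.exp (-z * p + p ^ 3 / 3)) p := by fun_prop
  exact (h1.mul h2).differentiableWithinAt

theorem integrable_of_norm_le_gaussian {f : ℝ → ℂ} (hf : AEStronglyMeasurable f) {C c : ℝ}
    (hc : 0 < c) (h : ∀ s, ‖f s‖ ≤ C * Real.exp (-c * s ^ 2)) : Integrable f :=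
  ((integrable_exp_neg_mul_sq hc).const_mul C).mono' hf (Eventually.of_forall h)

/-- The generalised Airy function as an integral over a vertical line. -/
theorem genAiry_eq_integral_airyLine (k : ℤ) (z : ℂ) :
    genAiry k z = (-1 : ℂ) ^ k * ((√3 / 2 : ℝ) : ℂ) / (2 * (Real.pi : ℂ)) *
      ∫ s : ℝ, airyIntegrand k z (airyLine s) := by
  obtain ⟨C, hC0, hC⟩ := exists_norm_airyIntegrand_le k ‖z‖
  have hU : IsOpen {p : ℂ | 0 < p.re} := isOpen_lt continuous_const Complex.continuous_re
  have hc1 : Continuous (airyPath (Real.pi / 3)) := by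
    rw [funext airyPath_pi_div_three]; fun_prop
  have hU0 : ∀ s, airyLine s ∈ {p : ℂ | 0 < p.re} := fun s => by
    simp [airyLine_re]
  have hU1 : ∀ s, airyPath (Real.pi / 3) s ∈ {p : ℂ | 0 < p.re} := fun s => by
    rw [airyPath_pi_div_three]
    simp
  have hgc := (differentiableOn_airyIntegrand k z).continuousOn
  have hg0 : Continuous fun s => airyIntegrand k z (airyLine s) :=
    hgc.comp_continuous continuous_airyLine hU0
  have hg1 : Continuous fun s => airyIntegrand k z (airyPath (Real.pi / 3) s) :=
    hgc.comp_continuous hc1 hU1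
  have hone : ∀ s : ℝ, 1 ≤ 1 + |s| := fun s => by linarith [abs_nonneg s]
  have hmax : ∀ s : ℝ, 1 / 2 ≤ max (1 / 2) (|s| / 2) := fun s => le_max_left _ _
  have hd : ∀ s, HasDerivAt airyLine (Complex.I * ((√3 / 2 : ℝ) : ℂ)) s := fun s => by
    have h : HasDerivAt (fun s : ℝ => ((√3 / 2 * s : ℝ) : ℂ)) ((√3 / 2 * 1 : ℝ) : ℂ) s :=
      ((hasDerivAt_id s).const_mul (√3 / 2)).ofReal_comp
    have h2 := (h.const_mul Complex.I).const_add ((1 / 2 : ℝ) : ℂ)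
    rwa [mul_one] at h2
  have hint0 : Integrable fun s => airyIntegrand k z (airyLine s) :=
    integrable_of_norm_le_gaussian hg0.aestronglyMeasurable (by norm_num : (0 : ℝ) < 1 / 6)
      fun s => (le_mul_of_one_le_right (norm_nonneg _) (hone s)).trans
        (hC z le_rfl (1 / 2) s le_rfl (hmax s))
  have hint1 : Integrable fun s => airyIntegrand k z (airyPath (Real.pi / 3) s) *
      airyPathDeriv (Real.pi / 3) s := by
    refine integrable_of_norm_le_gaussian (C := C)
      (hg1.aestronglyMeasurable.mul (measurable_airyPathDeriv _).aestronglyMeasurable)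
      (by norm_num : (0 : ℝ) < 1 / 6) fun s => ?_
    have h := hC z le_rfl _ s (hmax s) le_rfl
    rw [← airyPath_pi_div_three] at h
    rw [norm_mul]
    refine le_trans ?_ h
    gcongr
    exact (norm_airyPathDeriv_le _ s).trans (hone s)
  have hsub : ∀ s, airyPath (Real.pi / 3) s - airyLine s =
      ((max (1 / 2) (|s| / 2) - 1 / 2 : ℝ) : ℂ) := fun s => by
    rw [airyPath_pi_div_three, airyLine]; push_cast; ring
  have heq := integral_path_eq_of_convex hU (convex_halfSpace_re_gt 0)
    (differentiableOn_airyIntegrand k z) (Set.toFinite ({-1, 1} : Set ℝ)).countable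
    continuous_airyLine hc1 hU0 hU1 (fun s _ => hd s) (fun s hs => hasDerivAt_airyPath _ hs)
    (hint0.mul_const _) hint1 (b := fun s => C * Real.exp (-(1 / 6) * s ^ 2)) ?_
    (tendsto_const_mul_gaussian C (by norm_num) tendsto_abs_atTop_atTop)
    (tendsto_const_mul_gaussian C (by norm_num) tendsto_abs_atBot_atTop)
  · rw [integral_mul_const] at heq
    simp only [airyIntegrand] at heq ⊢
    rw [genAiry, ← heq]
    have := Complex.I_ne_zero
    have := Complex.ofReal_ne_zero.2 Real.pi_ne_zero
    field_simp
  · intro s p hp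
    rw [segment_eq_image'] at hp
    obtain ⟨θ, hθ, rfl⟩ := hp
    set m : ℝ := max (1 / 2) (|s| / 2) with hm
    have hm' : 0 ≤ m - 1 / 2 := sub_nonneg.2 (hmax s)
    have hpt : airyLine s + θ • (airyPath (Real.pi / 3) s - airyLine s) =
        ((1 / 2 + θ * (m - 1 / 2) : ℝ) : ℂ) + Complex.I * ((√3 / 2 * s : ℝ) : ℂ) := by
      rw [hsub, airyLine, Complex.real_smul]
      push_cast; ring
    have h1 : 0 ≤ θ * (m - 1 / 2) := mul_nonneg hθ.1 hm'
    have h2 : θ * (m - 1 / 2) ≤ m - 1 / 2 := mul_le_of_le_one_left hm' hθ.2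
    dsimp only
    rw [hpt]
    refine le_trans ?_ (hC z le_rfl (1 / 2 + θ * (m - 1 / 2)) s (by linarith) (by linarith))
    gcongr
    rw [hsub, Complex.norm_real, Real.norm_eq_abs, abs_of_nonneg hm']
    have : m ≤ 1 / 2 + |s| / 2 :=
      max_le (by linarith [abs_nonneg s]) (by linarith [abs_nonneg s])
    linarith [abs_nonneg s]

/-- Shifting a horizontal line of integration against a Gaussian. -/
theorem integral_gaussian_mul_eq_shift {w c c' : ℝ} (hw : 0 < w) (hc : 0 ≤ c) (hcc' : c < c')
    {H : ℂ → ℂ} (hH : DifferentiableOn ℂ H {x | x.im < c'}) {M : ℝ}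
    (hM : ∀ x : ℂ, 0 ≤ x.im → x.im ≤ c → ‖H x‖ ≤ M) :
    ∫ x : ℝ, Complex.exp (-(x : ℂ) ^ 2 / (2 * (w : ℂ))) * H x =
      ∫ x : ℝ, Complex.exp (-((x : ℂ) + c * Complex.I) ^ 2 / (2 * (w : ℂ))) *
        H ((x : ℂ) + c * Complex.I) := by
  set g : ℂ → ℂ := fun x => Complex.exp (-x ^ 2 / (2 * (w : ℂ))) * H x with hg
  have hgd : DifferentiableOn ℂ g {x | x.im < c'} := by
    refine DifferentiableOn.mul ?_ hH
    fun_prop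
  have hM0 : 0 ≤ M := (norm_nonneg _).trans (hM 0 (by simp) (by simpa using hc))
  set C : ℝ := Real.exp (c ^ 2 / (2 * w)) * M with hC
  have hbound : ∀ x y : ℝ, 0 ≤ y → y ≤ c →
      ‖g ((x : ℂ) + y * Complex.I)‖ ≤ C * Real.exp (-(1 / (2 * w)) * x ^ 2) := by
    intro x y hy hyc
    have hre : (-((x : ℂ) + y * Complex.I) ^ 2 / (2 * (w : ℂ))).re = (y ^ 2 - x ^ 2) / (2 * w) := by
      rw [show (2 * (w : ℂ)) = ((2 * w : ℝ) : ℂ) by push_cast; ring, Complex.div_ofReal_re]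
      congr 1
      simp [pow_two]
    rw [hg]
    dsimp only
    rw [norm_mul, Complex.norm_exp, hre]
    calc _ ≤ Real.exp (c ^ 2 / (2 * w) + -(1 / (2 * w)) * x ^ 2) * M := by
          gcongr
          · rw [sub_div]
            have : y ^ 2 / (2 * w) ≤ c ^ 2 / (2 * w) := by gcongr
            have h2 : x ^ 2 / (2 * w) = 1 / (2 * w) * x ^ 2 := by ring
            linarith
          · exact hM _ (by simpa using hy) (by simpa using hyc)
      _ = _ := by rw [Real.exp_add]; ring
  have hU : IsOpen {x : ℂ | x.im < c'} := isOpen_lt Complex.continuous_im continuous_const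
  have hb0 : (0 : ℝ) < 1 / (2 * w) := by positivity
  have hU0 : ∀ t : ℝ, (t : ℂ) ∈ {x : ℂ | x.im < c'} := fun t => by
    simp only [Set.mem_ofPred_eq, Complex.ofReal_im]; linarith
  have hU1 : ∀ t : ℝ, (t : ℂ) + c * Complex.I ∈ {x : ℂ | x.im < c'} := fun t => by
    simpa using hcc'
  have hi0 : Integrable fun t : ℝ => g t := by
    refine integrable_of_norm_le_gaussian (C := C)
      (hgd.continuousOn.comp_continuous Complex.continuous_ofReal hU0).aestronglyMeasurable
      hb0 fun x => ?_
    simpa using hbound x 0 le_rfl hc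
  have hi1 : Integrable fun t : ℝ => g ((t : ℂ) + c * Complex.I) :=
    integrable_of_norm_le_gaussian (C := C)
      (hgd.continuousOn.comp_continuous (by fun_prop) hU1).aestronglyMeasurable
      hb0 fun x => hbound x c hc le_rfl
  have hid : ∀ t : ℝ, HasDerivAt (fun t : ℝ => (t : ℂ)) 1 t := fun t =>
    Complex.ofRealCLM.hasDerivAt
  have := integral_path_eq_of_convex hU (convex_halfSpace_im_lt c') hgd Set.countable_empty
    Complex.continuous_ofReal (γ₁ := fun t : ℝ => (t : ℂ) + c * Complex.I) (by fun_prop) hU0 hU1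
    (fun t _ => hid t) (fun t _ => (hid t).add_const _) (by simpa using hi0) (by simpa using hi1)
    (b := fun t => (C * c) * Real.exp (-(1 / (2 * w)) * t ^ 2)) ?_
    (tendsto_const_mul_gaussian _ hb0 tendsto_abs_atTop_atTop)
    (tendsto_const_mul_gaussian _ hb0 tendsto_abs_atBot_atTop)
  · simpa using this
  · intro t p hp
    rw [segment_eq_image'] at hp
    obtain ⟨θ, hθ, rfl⟩ := hp
    have hpt : (t : ℂ) + θ • ((t : ℂ) + c * Complex.I - t) =
        (t : ℂ) + ((θ * c : ℝ) : ℂ) * Complex.I := by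
      rw [Complex.real_smul]; push_cast; ring
    have hn : ‖(t : ℂ) + c * Complex.I - t‖ = c := by
      simp [abs_of_nonneg hc]
    dsimp only
    rw [hpt, hn]
    calc _ ≤ C * Real.exp (-(1 / (2 * w)) * t ^ 2) * c := by
          gcongr
          exact hbound t (θ * c) (mul_nonneg hθ.1 hc) (mul_le_of_le_one_left hc hθ.2)
      _ = _ := by ring

theorem norm_exp_neg_I_mul (x : ℂ) : ‖Complex.exp (-Complex.I * x)‖ = Real.exp x.im := by
  rw [Complex.norm_exp]; simp

theorem phiR_eq_integral_shift (r : ℤ) {F : ℂ → ℂ} (hF : Differentiable ℂ F) (z : ℂ) {w wp c c' : ℝ}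
    (hw : 0 < w) (hc : 0 ≤ c) (hcc' : c < c') (hz : ‖z * wp‖ * Real.exp c' < 1) :
    phiR r z w wp F = (1 / (Real.sqrt (2 * Real.pi * w) : ℂ)) *
      ∫ x : ℝ, (1 - z * (wp : ℂ) * Complex.exp (-Complex.I * ((x : ℂ) + c * Complex.I))) ^ r *
        Complex.exp (-((x : ℂ) + c * Complex.I) ^ 2 / (2 * (w : ℂ)) -
          z * Complex.exp (-Complex.I * ((x : ℂ) + c * Complex.I))) *
        F (z * (wp : ℂ) * Complex.exp (-Complex.I * ((x : ℂ) + c * Complex.I))) := by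
  set ρ : ℝ := ‖z * wp‖ * Real.exp c with hρ
  have hρ1 : ρ < 1 := lt_of_le_of_lt
    (mul_le_mul_of_nonneg_left (Real.exp_le_exp.2 hcc'.le) (norm_nonneg _)) hz
  have hne : ∀ q : ℂ, ‖q‖ < 1 → 1 - q ≠ 0 := fun q hq h => by
    rw [← sub_eq_zero.1 h] at hq
    simp at hq
  have hKc : ContinuousOn (fun q : ℂ => (1 - q) ^ r * F q) (Metric.closedBall 0 ρ) := by
    refine ContinuousOn.mul ?_ hF.continuous.continuousOn
    refine ContinuousOn.zpow₀ (by fun_prop) r fun q hq => Or.inl (hne q ?_)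
    rw [mem_closedBall_zero_iff] at hq
    linarith
  obtain ⟨K, hK⟩ := (isCompact_closedBall (0 : ℂ) ρ).exists_bound_of_continuousOn hKc
  have hK0 : 0 ≤ K := (norm_nonneg _).trans (hK 0 (by simp [hρ]; positivity))
  set H : ℂ → ℂ := fun x => (1 - z * (wp : ℂ) * Complex.exp (-Complex.I * x)) ^ r *
    Complex.exp (-(z * Complex.exp (-Complex.I * x))) *
    F (z * (wp : ℂ) * Complex.exp (-Complex.I * x)) with hH
  have hHd : DifferentiableOn ℂ H {x | x.im < c'} := by
    intro x hx
    have hq : 1 - z * (wp : ℂ) * Complex.exp (-Complex.I * x) ≠ 0 := by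
      refine hne _ (lt_of_le_of_lt ?_ hz)
      rw [norm_mul, norm_exp_neg_I_mul]
      have : x.im ≤ c' := le_of_lt hx
      gcongr
    have h1 : DifferentiableAt ℂ
        (fun x => (1 - z * (wp : ℂ) * Complex.exp (-Complex.I * x)) ^ r) x :=
      DifferentiableAt.zpow (by fun_prop) (Or.inl hq)
    have h2 : DifferentiableAt ℂ
        (fun x => Complex.exp (-(z * Complex.exp (-Complex.I * x)))) x := by fun_prop
    have h3 : DifferentiableAt ℂ
        (fun x => F (z * (wp : ℂ) * Complex.exp (-Complex.I * x))) x := by fun_prop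
    exact ((h1.mul h2).mul h3).differentiableWithinAt
  have hHM : ∀ x : ℂ, 0 ≤ x.im → x.im ≤ c → ‖H x‖ ≤ K * Real.exp (‖z‖ * Real.exp c) := by
    intro x _ hxc
    have h1 := hK (z * (wp : ℂ) * Complex.exp (-Complex.I * x)) (by
      rw [mem_closedBall_zero_iff, norm_mul, norm_exp_neg_I_mul, hρ]
      gcongr)
    have h2 : ‖Complex.exp (-(z * Complex.exp (-Complex.I * x)))‖ ≤
        Real.exp (‖z‖ * Real.exp c) := by
      rw [Complex.norm_exp, Real.exp_le_exp]
      refine (Complex.re_le_norm _).trans ?_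
      rw [norm_neg, norm_mul, norm_exp_neg_I_mul]
      gcongr
    calc ‖H x‖ = ‖(1 - z * (wp : ℂ) * Complex.exp (-Complex.I * x)) ^ r *
          F (z * (wp : ℂ) * Complex.exp (-Complex.I * x))‖ *
          ‖Complex.exp (-(z * Complex.exp (-Complex.I * x)))‖ := by
          rw [hH, ← norm_mul]; ring_nf
      _ ≤ _ := by gcongr
  have key := integral_gaussian_mul_eq_shift hw hc hcc' hHd hHM
  have hsplit : ∀ x : ℂ, (1 - z * (wp : ℂ) * Complex.exp (-Complex.I * x)) ^ r *
      Complex.exp (-x ^ 2 / (2 * (w : ℂ)) - z * Complex.exp (-Complex.I * x)) *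
      F (z * (wp : ℂ) * Complex.exp (-Complex.I * x)) =
      Complex.exp (-x ^ 2 / (2 * (w : ℂ))) * H x := fun x => by
    rw [hH, sub_eq_add_neg (-x ^ 2 / (2 * (w : ℂ))), Complex.exp_add]; ring
  rw [phiR]
  simp only [hsplit]
  rw [key]

/-- The integrand of `φ_r` on the line through the double saddle point, rescaled by `h = w^{1/3}`;
the parameter `β` stands for `2^{1/3}`. -/
noncomputable def scaledIntegrand (r : ℤ) (F : ℂ → ℂ) (β h : ℝ) (κ τ : ℂ) (s : ℝ) : ℂ :=
  ((1 - κ * Complex.exp (-(h * β * airyLine s))) / (h * β)) ^ r *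
    Complex.exp ((1 + -(h * β * airyLine s) + (-(h * β * airyLine s)) ^ 2 / 2 -
      Complex.exp (-(h * β * airyLine s))) / h ^ 3 +
      τ * ((Complex.exp (-(h * β * airyLine s)) - 1) / h)) *
    F (κ * Complex.exp (-(h * β * airyLine s)))

theorem phiR_eq_integral_scaledIntegrand (r : ℤ) {F : ℂ → ℂ} (hF : Differentiable ℂ F) {β h : ℝ}
    (hβ : 0 < β) (hh : 0 < h) (hhβ : h * β ≤ 2) (κ τ : ℂ) {wp : ℝ}
    (hκ : κ = (1 - τ * h ^ 2) * wp / h ^ 3) (hκn : ‖κ‖ < Real.exp (h * β / 4)) :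
    phiR r ((1 - τ * h ^ 2) / ((Real.exp 1 * h ^ 3 : ℝ) : ℂ)) (h ^ 3) wp F =
      (1 / (Real.sqrt (2 * Real.pi * h ^ 3) : ℂ)) * ((h * β * (√3 / 2) : ℝ) : ℂ) *
        ((h * β : ℝ) : ℂ) ^ r * Complex.exp (-1 / (2 * (h : ℂ) ^ 3) + τ / h) *
        ∫ s : ℝ, scaledIntegrand r F β h κ τ s := by
  have hh0 : (h : ℂ) ≠ 0 := Complex.ofReal_ne_zero.2 hh.ne'
  have hβ0 : (β : ℂ) ≠ 0 := Complex.ofReal_ne_zero.2 hβ.ne'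
  have hzκ : (1 - τ * h ^ 2) / ((Real.exp 1 * h ^ 3 : ℝ) : ℂ) * wp = κ * Complex.exp (-1) := by
    rw [hκ, Complex.exp_neg]
    push_cast
    field_simp
  have hzn : ‖(1 - τ * h ^ 2) / ((Real.exp 1 * h ^ 3 : ℝ) : ℂ) * wp‖ *
      Real.exp (1 - h * β / 4) < 1 := by
    rw [hzκ, norm_mul, Complex.norm_exp, mul_assoc, ← Real.exp_add]
    calc _ < Real.exp (h * β / 4) * Real.exp ((-1 : ℂ).re + (1 - h * β / 4)) := by gcongr
      _ = 1 := by rw [← Real.exp_add, Complex.neg_re, Complex.one_re]; ring_nf; exact Real.exp_zero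
  have hhβ0 : 0 < h * β := by positivity
  rw [phiR_eq_integral_shift r hF _ (c := 1 - h * β / 2) (by positivity) (by linarith)
    (by linarith) hzn]
  have ha : 0 < h * β * (√3 / 2) := by positivity
  have hsub := MeasureTheory.Measure.integral_comp_mul_left (fun x : ℝ =>
    (1 - (1 - τ * h ^ 2) / ((Real.exp 1 * h ^ 3 : ℝ) : ℂ) * (wp : ℂ) *
        Complex.exp (-Complex.I * ((x : ℂ) + ((1 - h * β / 2 : ℝ) : ℂ) * Complex.I))) ^ r *
      Complex.exp (-((x : ℂ) + ((1 - h * β / 2 : ℝ) : ℂ) * Complex.I) ^ 2 /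
          (2 * ((h ^ 3 : ℝ) : ℂ)) -
        (1 - τ * h ^ 2) / ((Real.exp 1 * h ^ 3 : ℝ) : ℂ) *
        Complex.exp (-Complex.I * ((x : ℂ) + ((1 - h * β / 2 : ℝ) : ℂ) * Complex.I))) *
      F ((1 - τ * h ^ 2) / ((Real.exp 1 * h ^ 3 : ℝ) : ℂ) * (wp : ℂ) *
        Complex.exp (-Complex.I * ((x : ℂ) + ((1 - h * β / 2 : ℝ) : ℂ) * Complex.I))))
    (h * β * (√3 / 2))
  rw [abs_of_pos (inv_pos.2 ha), Complex.real_smul] at hsub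
  have hsub' := (eq_div_iff_mul_eq (by
    exact_mod_cast (inv_pos.2 ha).ne')).2 ((mul_comm _ _).trans hsub.symm)
  rw [hsub', Complex.ofReal_inv, div_inv_eq_mul]
  have hpt : ∀ s : ℝ, (((h * β * (√3 / 2) * s : ℝ) : ℂ)) +
      ((1 - h * β / 2 : ℝ) : ℂ) * Complex.I = Complex.I * (1 + -(h * β * airyLine s)) := by
    intro s
    rw [airyLine]
    push_cast
    linear_combination ((h * β * (√3 / 2) * s) : ℂ) * Complex.I_sq
  have hintegrand : ∀ s : ℝ, (1 - (1 - τ * h ^ 2) / ((Real.exp 1 * h ^ 3 : ℝ) : ℂ) * (wp : ℂ) *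
        Complex.exp (-Complex.I * (Complex.I * (1 + -(h * β * airyLine s))))) ^ r *
      Complex.exp (-(Complex.I * (1 + -(h * β * airyLine s))) ^ 2 / (2 * ((h ^ 3 : ℝ) : ℂ)) -
        (1 - τ * h ^ 2) / ((Real.exp 1 * h ^ 3 : ℝ) : ℂ) *
        Complex.exp (-Complex.I * (Complex.I * (1 + -(h * β * airyLine s))))) *
      F ((1 - τ * h ^ 2) / ((Real.exp 1 * h ^ 3 : ℝ) : ℂ) * (wp : ℂ) *
        Complex.exp (-Complex.I * (Complex.I * (1 + -(h * β * airyLine s))))) =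
      ((h * β : ℝ) : ℂ) ^ r * Complex.exp (-1 / (2 * (h : ℂ) ^ 3) + τ / h) *
        scaledIntegrand r F β h κ τ s := by
    intro s
    rw [scaledIntegrand]
    set u : ℂ := -(h * β * airyLine s) with hu
    have hII : -Complex.I * (Complex.I * (1 + u)) = 1 + u := by
      linear_combination (-(1 + u)) * Complex.I_sq
    have hee : Complex.exp (-1) * Complex.exp (1 + u) = Complex.exp u := by
      rw [← Complex.exp_add]; ring_nf
    have hexp : -(Complex.I * (1 + u)) ^ 2 / (2 * ((h ^ 3 : ℝ) : ℂ)) -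
        (1 - τ * h ^ 2) / ((Real.exp 1 * h ^ 3 : ℝ) : ℂ) * Complex.exp (1 + u) =
        (-1 / (2 * (h : ℂ) ^ 3) + τ / h) + ((1 + u + u ^ 2 / 2 - Complex.exp u) / h ^ 3 +
          τ * ((Complex.exp u - 1) / h)) := by
      rw [mul_pow, Complex.I_sq, Complex.exp_add]
      push_cast
      have := Complex.exp_ne_zero 1
      field_simp
      ring
    rw [hII, hzκ, mul_assoc κ, hee, hexp, Complex.exp_add (-1 / (2 * (h : ℂ) ^ 3) + τ / h),
      div_zpow, Complex.ofReal_mul]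
    have : ((h : ℂ) * β) ^ r ≠ 0 := zpow_ne_zero _ (mul_ne_zero hh0 hβ0)
    field_simp
  simp only [hpt, hintegrand]
  rw [integral_const_mul]
  ring

theorem norm_exp_sub_one_le_of_re_nonpos {u : ℂ} (hu : u.re ≤ 0) :
    ‖Complex.exp u - 1‖ ≤ ‖u‖ := by
  have h := Convex.norm_image_sub_le_of_norm_hasDerivWithin_le (s := {z : ℂ | z.re ≤ 0}) (C := 1)
    (f := Complex.exp) (f' := Complex.exp) (x := 0) (y := u)
    (fun x _ => (Complex.hasDerivAt_exp x).hasDerivWithinAt)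
    (fun x hx => by rw [Complex.norm_exp]; exact Real.exp_le_one_iff.2 hx)
    (convex_halfSpace_re_le 0) (by simp) hu
  simpa using h

theorem half_le_one_sub_exp_neg {ε : ℝ} (h0 : 0 ≤ ε) (h1 : ε ≤ 1) :
    ε / 2 ≤ 1 - Real.exp (-ε) := by
  have h : Real.exp (-ε) ≤ (1 + ε)⁻¹ := by
    rw [Real.exp_neg]
    exact inv_anti₀ (by linarith) (by linarith [Real.add_one_le_exp ε])
  have h' : (1 + ε)⁻¹ ≤ 1 - ε / 2 := by
    rw [inv_le_iff_one_le_mul₀ (by linarith)]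
    nlinarith
  linarith

theorem one_sub_add_sq_sub_exp_neg_le {ε : ℝ} (h0 : 0 ≤ ε) (h1 : ε ≤ 1) :
    1 - ε + ε ^ 2 / 2 - Real.exp (-ε) ≤ ε ^ 3 := by
  have h := Real.exp_bound (x := -ε) (by rw [abs_neg, abs_of_nonneg h0]; exact h1) (n := 3)
    (by norm_num)
  rw [abs_neg, abs_of_nonneg h0] at h
  simp only [Finset.sum_range_succ, Finset.sum_range_zero, Nat.factorial] at h
  have h' := (abs_le.1 h).1
  norm_num at h'
  nlinarith [pow_nonneg h0 3]

section Bounds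

variable {β h : ℝ} {κ τ : ℂ}

theorem scaled_re (s : ℝ) : (-(h * β * airyLine s) : ℂ).re = -(h * β / 2) := by
  rw [Complex.neg_re, ← Complex.ofReal_mul, Complex.re_ofReal_mul, airyLine_re]
  ring

theorem scaled_im (s : ℝ) : (-(h * β * airyLine s) : ℂ).im = -(h * β * (√3 / 2 * s)) := by
  rw [Complex.neg_im, ← Complex.ofReal_mul, Complex.im_ofReal_mul, airyLine_im]

theorem norm_scaled_le (hβ : 0 < β) (hh : 0 < h) (s : ℝ) :
    ‖(-(h * β * airyLine s) : ℂ)‖ ≤ h * β * (1 / 2 + |s|) := by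
  rw [norm_neg, norm_mul, ← Complex.ofReal_mul, Complex.norm_real, Real.norm_eq_abs,
    abs_of_pos (by positivity)]
  gcongr
  exact norm_airyLine_le s

theorem norm_exp_scaled (s : ℝ) :
    ‖Complex.exp (-(h * β * airyLine s))‖ = Real.exp (-(h * β / 2)) := by
  rw [Complex.norm_exp, scaled_re]

theorem norm_one_sub_mul_exp_scaled (hβ : 0 < β) (hh : 0 < h) (hhβ : h * β ≤ 2)
    (hκ : ‖1 - κ‖ ≤ h * β / 8) (s : ℝ) :
    1 / 8 ≤ ‖(1 - κ * Complex.exp (-(h * β * airyLine s))) / (h * β)‖ ∧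
      ‖(1 - κ * Complex.exp (-(h * β * airyLine s))) / (h * β)‖ ≤ 1 + |s| := by
  have hhβ0 : 0 < h * β := by positivity
  have hn : ‖(h * β : ℂ)‖ = h * β := by
    rw [← Complex.ofReal_mul, Complex.norm_real, Real.norm_eq_abs, abs_of_pos hhβ0]
  have hre : (-(h * β * airyLine s) : ℂ).re ≤ 0 := by rw [scaled_re]; linarith
  have hnu := norm_exp_scaled (β := β) (h := h) s
  have hule := norm_exp_sub_one_le_of_re_nonpos hre
  have hu := norm_scaled_le hβ hh s
  set u : ℂ := -(h * β * airyLine s)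
  have hexp : Real.exp (-(h * β / 2)) ≤ 1 := Real.exp_le_one_iff.2 (by linarith)
  have hlow := half_le_one_sub_exp_neg (ε := h * β / 2) (by linarith) (by linarith)
  have hsplit : 1 - κ * Complex.exp u = (1 - Complex.exp u) + (1 - κ) * Complex.exp u := by ring
  have hsec : ‖(1 - κ) * Complex.exp u‖ ≤ h * β / 8 := by
    rw [norm_mul, hnu]
    calc _ ≤ h * β / 8 * 1 := by gcongr
      _ = _ := mul_one _
  have hone : 1 - Real.exp (-(h * β / 2)) ≤ ‖1 - Complex.exp u‖ := by
    have := norm_sub_norm_le (1 : ℂ) (Complex.exp u)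
    rwa [norm_one, hnu] at this
  rw [norm_div, hn]
  constructor
  · rw [le_div_iff₀ hhβ0, hsplit]
    have := norm_sub_le_norm_add (1 - Complex.exp u) ((1 - κ) * Complex.exp u)
    linarith
  · rw [div_le_iff₀ hhβ0, hsplit]
    have h1 := norm_add_le (1 - Complex.exp u) ((1 - κ) * Complex.exp u)
    have h2 : ‖1 - Complex.exp u‖ = ‖Complex.exp u - 1‖ := norm_sub_rev _ _
    linarith

theorem re_quadratic_sub_exp_scaled_le (hβ : 0 < β) (hβ3 : β ^ 3 = 2) (hh : 0 < h)
    (hhβ : h * β ≤ 2) (s : ℝ) :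
    ((1 + -(h * β * airyLine s) + (-(h * β * airyLine s)) ^ 2 / 2 -
      Complex.exp (-(h * β * airyLine s))) / (h : ℂ) ^ 3).re ≤ 1 / 4 - 3 / 16 * s ^ 2 := by
  have hhβ0 : 0 < h * β := by positivity
  have hre := scaled_re (β := β) (h := h) s
  have him := scaled_im (β := β) (h := h) s
  set u : ℂ := -(h * β * airyLine s)
  set ε : ℝ := h * β / 2 with hε
  set θ : ℝ := h * β * (√3 / 2 * s) with hθ
  rw [← Complex.ofReal_pow, Complex.div_ofReal_re, div_le_iff₀ (by positivity)]
  have hval : (1 + u + u ^ 2 / 2 - Complex.exp u).re =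
      1 - ε + (ε ^ 2 - θ ^ 2) / 2 - Real.exp (-ε) * Real.cos θ := by
    rw [Complex.sub_re, Complex.exp_re, hre, him, Real.cos_neg, Complex.add_re, Complex.add_re, hre,
      show (2 : ℂ) = ((2 : ℝ) : ℂ) by norm_num, Complex.div_ofReal_re, pow_two, Complex.mul_re, hre,
      him, Complex.one_re]
    ring
  rw [hval]
  have h1 := one_sub_add_sq_sub_exp_neg_le (ε := ε) (by linarith) (by linarith)
  have h2 := half_le_one_sub_exp_neg (ε := ε) (by linarith) (by linarith)
  have h3 := mul_le_mul_of_nonneg_left (Real.one_sub_sq_div_two_le_cos (x := θ))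
    (Real.exp_pos (-ε)).le
  have h4 : ε / 2 * (θ ^ 2 / 2) ≤ (1 - Real.exp (-ε)) * (θ ^ 2 / 2) := by gcongr
  have h5 : √3 ^ 2 = 3 := Real.sq_sqrt (by norm_num)
  have h6 : ε ^ 3 = 1 / 4 * h ^ 3 := by
    rw [hε]; linear_combination (h ^ 3 / 8) * hβ3
  have h7 : ε / 2 * (θ ^ 2 / 2) = 3 / 16 * s ^ 2 * h ^ 3 := by
    rw [hε, hθ]
    linear_combination (h ^ 3 * s ^ 2 * √3 ^ 2 / 32) * hβ3 + (h ^ 3 * s ^ 2 / 16) * h5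
  linarith

theorem exists_norm_scaledIntegrand_le (r : ℤ) {F : ℂ → ℂ} (hF : Continuous F) (T : ℝ)
    (hβ : 0 < β) (hβ3 : β ^ 3 = 2) :
    ∃ C, ∀ (h : ℝ) (κ τ : ℂ), 0 < h → h * β ≤ 2 → ‖1 - κ‖ ≤ h * β / 8 → ‖τ‖ ≤ T → ∀ s : ℝ,
      ‖scaledIntegrand r F β h κ τ s‖ ≤ C * Real.exp (-(3 / 32) * s ^ 2) := by
  obtain ⟨C, -, hC⟩ := exists_pow_mul_exp_mul_gaussian_le r.natAbs (2 * T)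
    (by norm_num : (0 : ℝ) < 3 / 16)
  obtain ⟨K, hK⟩ := (isCompact_closedBall (0 : ℂ) 2).exists_bound_of_continuousOn hF.continuousOn
  have hK0 : 0 ≤ K := (norm_nonneg _).trans (hK 0 (by simp))
  refine ⟨K * Real.exp (1 / 4) * C, fun h κ τ hh hhβ hκ hτ s => ?_⟩
  have hβ2 : β ≤ 2 := by
    by_contra! hlt
    nlinarith [mul_pos (mul_pos hβ hβ) hβ, mul_pos hβ hβ]
  have hT : 0 ≤ T := (norm_nonneg τ).trans hτ
  have hs := abs_nonneg s
  obtain ⟨hq1, hq2⟩ := norm_one_sub_mul_exp_scaled hβ hh hhβ hκ s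
  have hE := re_quadratic_sub_exp_scaled_le hβ hβ3 hh hhβ s
  have hre : (-(h * β * airyLine s) : ℂ).re ≤ 0 := by
    rw [scaled_re]; linarith [mul_pos hh hβ]
  have hule := (norm_exp_sub_one_le_of_re_nonpos hre).trans (norm_scaled_le hβ hh s)
  have hFq : ‖F (κ * Complex.exp (-(h * β * airyLine s)))‖ ≤ K := by
    refine hK _ ?_
    rw [mem_closedBall_zero_iff, norm_mul, Complex.norm_exp]
    have h1 : ‖κ‖ ≤ 2 := by
      have := norm_sub_norm_le κ 1
      rw [norm_sub_rev, norm_one] at this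
      linarith
    refine (mul_le_mul h1 (Real.exp_le_one_iff.2 hre) (Real.exp_pos _).le two_pos.le).trans ?_
    norm_num
  rw [scaledIntegrand]
  set u : ℂ := -(h * β * airyLine s)
  set q : ℂ := (1 - κ * Complex.exp u) / (h * β)
  have hqp : ‖q ^ r‖ ≤ (8 * (1 + |s|)) ^ r.natAbs := by
    refine norm_zpow_le_pow_natAbs r (by linarith) ?_
    have : ‖q‖⁻¹ ≤ (1 / 8)⁻¹ := inv_anti₀ (by norm_num) hq1
    norm_num at this
    linarith
  have hexp : ‖Complex.exp ((1 + u + u ^ 2 / 2 - Complex.exp u) / h ^ 3 +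
      τ * ((Complex.exp u - 1) / h))‖ ≤
      Real.exp (1 / 4 + (2 * T * (1 + |s|) + -(3 / 16) * s ^ 2)) := by
    rw [Complex.norm_exp, Real.exp_le_exp, Complex.add_re]
    have h1 : (τ * ((Complex.exp u - 1) / h)).re ≤ 2 * T * (1 + |s|) := by
      refine (Complex.re_le_norm _).trans ?_
      rw [norm_mul, norm_div, Complex.norm_real, Real.norm_eq_abs, abs_of_pos hh]
      have h2 : ‖Complex.exp u - 1‖ / h ≤ 2 * (1 + |s|) := by
        rw [div_le_iff₀ hh]
        refine hule.trans ?_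
        calc h * β * (1 / 2 + |s|) ≤ h * 2 * (1 + |s|) := by gcongr; norm_num
          _ = _ := by ring
      calc _ ≤ T * (2 * (1 + |s|)) := by gcongr
        _ = _ := by ring
    linarith
  calc _ ≤ (8 * (1 + |s|)) ^ r.natAbs *
        Real.exp (1 / 4 + (2 * T * (1 + |s|) + -(3 / 16) * s ^ 2)) * K := by
        rw [norm_mul, norm_mul]
        gcongr
    _ = K * Real.exp (1 / 4) * ((8 * (1 + |s|)) ^ r.natAbs * Real.exp (2 * T * (1 + |s|)) *
        Real.exp (-(3 / 16) * s ^ 2)) := by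
        rw [Real.exp_add, Real.exp_add]; ring
    _ ≤ K * Real.exp (1 / 4) * (C * Real.exp (-(3 / 16 / 2) * s ^ 2)) :=
        mul_le_mul_of_nonneg_left (hC s) (by positivity)
    _ = _ := by ring_nf

theorem continuous_scaledIntegrand (r : ℤ) {F : ℂ → ℂ} (hF : Continuous F) (hβ : 0 < β) (hh : 0 < h)
    (hhβ : h * β ≤ 2) (hκ : ‖1 - κ‖ ≤ h * β / 8) :
    Continuous (scaledIntegrand r F β h κ τ) := by
  have hv := continuous_airyLine
  have h1 : Continuous fun s => ((1 - κ * Complex.exp (-(h * β * airyLine s))) / (h * β)) ^ r := by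
    refine Continuous.zpow₀ (by fun_prop) r fun s => Or.inl ?_
    have := (norm_one_sub_mul_exp_scaled hβ hh hhβ hκ s).1
    exact norm_pos_iff.1 (by linarith)
  unfold scaledIntegrand
  refine (h1.mul ?_).mul ?_
  · fun_prop
  · fun_prop

end Bounds

theorem tendsto_quadratic_sub_exp_div_cube :
    Tendsto (fun u : ℂ => (1 + u + u ^ 2 / 2 - Complex.exp u) / u ^ 3) (𝓝[≠] 0) (𝓝 (-1 / 6)) := by
  rw [tendsto_iff_norm_sub_tendsto_zero]
  have hlim : Tendsto (fun u : ℂ => ‖u‖) (𝓝[≠] 0) (𝓝 0) := by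
    simpa using (continuous_norm (E := ℂ)).continuousAt.tendsto.mono_left
      (nhdsWithin_le_nhds (a := (0 : ℂ)) (s := {0}ᶜ))
  refine squeeze_zero' (Eventually.of_forall fun _ => norm_nonneg _) ?_ hlim
  filter_upwards [self_mem_nhdsWithin, hlim.eventually (ge_mem_nhds one_pos)] with u hu hu1
  have hu0 : u ≠ 0 := hu
  have h := Complex.exp_bound hu1 (n := 4) (by norm_num)
  have heq : (1 + u + u ^ 2 / 2 - Complex.exp u) / u ^ 3 - -1 / 6 =
      -(Complex.exp u - ∑ m ∈ Finset.range 4, u ^ m / (m.factorial : ℂ)) / u ^ 3 := by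
    simp only [Finset.sum_range_succ, Finset.sum_range_zero, Nat.factorial]
    push_cast
    field_simp
    ring
  rw [heq, norm_div, norm_neg, norm_pow, div_le_iff₀ (by positivity)]
  refine h.trans ?_
  calc _ ≤ ‖u‖ ^ 4 * 1 := by
        gcongr
        norm_num [Nat.factorial]
    _ = _ := by ring

section Limit

variable {ι : Type*} {l : Filter ι} {h : ι → ℝ} {κ τ : ι → ℂ} {τ₀ : ℂ} {β : ℝ}

theorem tendsto_scaledIntegrand (r : ℤ) {F : ℂ → ℂ} (hF : Continuous F)
    (hβ : 0 < β) (hβ3 : β ^ 3 = 2) (hh : Tendsto h l (𝓝[>] 0))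
    (hκ : Tendsto (fun i => (1 - κ i) / h i) l (𝓝 0)) (hτ : Tendsto τ l (𝓝 τ₀)) (s : ℝ) :
    Tendsto (fun i => scaledIntegrand r F β (h i) (κ i) (τ i) s) l
      (𝓝 (airyIntegrand r (β * τ₀) (airyLine s) * F 1)) := by
  have hβ0 : (β : ℂ) ≠ 0 := Complex.ofReal_ne_zero.2 hβ.ne'
  have hv := airyLine_ne_zero s
  have hpos : ∀ᶠ i in l, 0 < h i := hh.eventually self_mem_nhdsWithin
  have hne : ∀ᶠ i in l, (h i : ℂ) ≠ 0 := hpos.mono fun i hi => Complex.ofReal_ne_zero.2 hi.ne'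
  have hh0 : Tendsto (fun i => (h i : ℂ)) l (𝓝 0) := by
    have := (Complex.continuous_ofReal.tendsto 0).comp (hh.mono_right nhdsWithin_le_nhds)
    simpa [Function.comp_def] using this
  have hu0 : Tendsto (fun i => -(h i * β * airyLine s)) l (𝓝 0) := by
    simpa using ((hh0.mul_const (β : ℂ)).mul_const (airyLine s)).neg
  have hu : Tendsto (fun i => -(h i * β * airyLine s)) l (𝓝[≠] 0) := by
    refine tendsto_nhdsWithin_iff.2 ⟨hu0, hne.mono fun i hi => ?_⟩
    exact neg_ne_zero.2 (mul_ne_zero (mul_ne_zero hi hβ0) hv)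
  have hexp0 : Tendsto (fun i => Complex.exp (-(h i * β * airyLine s))) l (𝓝 1) := by
    simpa [Function.comp_def] using (Complex.continuous_exp.tendsto 0).comp hu0
  have hslope : Tendsto (fun u : ℂ => (Complex.exp u - 1) / u) (𝓝[≠] 0) (𝓝 1) := by
    have := hasDerivAt_iff_tendsto_slope.1 (Complex.hasDerivAt_exp 0)
    rw [Complex.exp_zero] at this
    refine this.congr fun u => ?_
    rw [slope_def_field, sub_zero, Complex.exp_zero]
  have hd : Tendsto (fun i => (Complex.exp (-(h i * β * airyLine s)) - 1) / h i) l
      (𝓝 (-(β * airyLine s))) := by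
    have := (hslope.comp hu).mul_const (-(β * airyLine s))
    rw [one_mul] at this
    refine this.congr' (hne.mono fun i hi => ?_)
    simp only [Function.comp_apply]
    field_simp
  have hκ1 : Tendsto κ l (𝓝 1) := by
    have := (hκ.mul hh0).const_sub 1
    rw [zero_mul, sub_zero] at this
    refine this.congr' (hne.mono fun i hi => ?_)
    field_simp
    ring
  have hq : Tendsto (fun i => (1 - κ i * Complex.exp (-(h i * β * airyLine s))) / (h i * β)) l
      (𝓝 (airyLine s)) := by
    have := (hκ.sub (hκ1.mul hd)).div_const (β : ℂ)
    rw [zero_sub, one_mul, neg_neg, mul_div_cancel_left₀ _ hβ0] at this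
    refine this.congr' (hne.mono fun i hi => ?_)
    field_simp
    ring
  have hcube : Tendsto (fun i => (1 + -(h i * β * airyLine s) + (-(h i * β * airyLine s)) ^ 2 / 2 -
      Complex.exp (-(h i * β * airyLine s))) / (h i : ℂ) ^ 3) l (𝓝 (airyLine s ^ 3 / 3)) := by
    have := (tendsto_quadratic_sub_exp_div_cube.comp hu).mul_const ((-(β * airyLine s)) ^ 3)
    have hβ3' : (β : ℂ) ^ 3 = 2 := by exact_mod_cast hβ3
    have hval : (-1 / 6 : ℂ) * (-(β * airyLine s)) ^ 3 = airyLine s ^ 3 / 3 := by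
      linear_combination (airyLine s ^ 3 / 6) * hβ3'
    rw [hval] at this
    refine this.congr' (hne.mono fun i hi => ?_)
    simp only [Function.comp_apply]
    field_simp
  have hE := (hcube.add (hτ.mul hd)).cexp
  have hFl : Tendsto (fun i => F (κ i * Complex.exp (-(h i * β * airyLine s)))) l (𝓝 (F 1)) := by
    have := hκ1.mul hexp0
    rw [one_mul] at this
    exact (hF.tendsto 1).comp this
  have := ((hq.zpow₀ r (Or.inl hv)).mul hE).mul hFl
  unfold scaledIntegrand airyIntegrand
  convert this using 5
  ring

theorem tendsto_integral_scaledIntegrand [l.IsCountablyGenerated] (r : ℤ) {F : ℂ → ℂ}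
    (hF : Continuous F) (hβ : 0 < β) (hβ3 : β ^ 3 = 2) (hh : Tendsto h l (𝓝[>] 0))
    (hκ : Tendsto (fun i => (1 - κ i) / h i) l (𝓝 0)) (hτ : Tendsto τ l (𝓝 τ₀)) :
    Tendsto (fun i => ∫ s : ℝ, scaledIntegrand r F β (h i) (κ i) (τ i) s) l
      (𝓝 ((∫ s : ℝ, airyIntegrand r (β * τ₀) (airyLine s)) * F 1)) := by
  obtain ⟨C, hC⟩ := exists_norm_scaledIntegrand_le r hF (‖τ₀‖ + 1) hβ hβ3
  have hpos : ∀ᶠ i in l, 0 < h i := hh.eventually self_mem_nhdsWithin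
  have hsmall : ∀ᶠ i in l, h i * β ≤ 2 := by
    have := (hh.mono_right nhdsWithin_le_nhds).mul_const β
    rw [zero_mul] at this
    exact this.eventually (ge_mem_nhds two_pos)
  have hκs : ∀ᶠ i in l, ‖1 - κ i‖ ≤ h i * β / 8 := by
    have := hκ.norm
    rw [norm_zero] at this
    filter_upwards [hpos, this.eventually (ge_mem_nhds (by positivity : 0 < β / 8))] with i hi hi2
    rw [norm_div, Complex.norm_real, Real.norm_eq_abs, abs_of_pos hi, div_le_iff₀ hi] at hi2
    linarith
  have hτs : ∀ᶠ i in l, ‖τ i‖ ≤ ‖τ₀‖ + 1 :=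
    hτ.norm.eventually (ge_mem_nhds (lt_add_one _))
  rw [← integral_mul_const]
  refine tendsto_integral_filter_of_dominated_convergence
    (fun s => C * Real.exp (-(3 / 32) * s ^ 2)) ?_ ?_
    ((integrable_exp_neg_mul_sq (by norm_num)).const_mul C)
    (Eventually.of_forall fun s => tendsto_scaledIntegrand r hF hβ hβ3 hh hκ hτ s)
  · filter_upwards [hpos, hsmall, hκs] with i h1 h2 h3
    exact (continuous_scaledIntegrand r hF hβ h1 h2 h3).aestronglyMeasurable
  · filter_upwards [hpos, hsmall, hκs, hτs] with i h1 h2 h3 h4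
    exact Eventually.of_forall (hC _ _ _ h1 h2 h3 h4)

end Limit

theorem continuous_integral_airyIntegrand (k : ℤ) :
    Continuous fun z : ℂ => ∫ s : ℝ, airyIntegrand k z (airyLine s) := by
  refine continuous_iff_continuousAt.2 fun z₀ => ?_
  obtain ⟨C, -, hC⟩ := exists_norm_airyIntegrand_airyLine_le k (‖z₀‖ + 1)
  refine continuousAt_of_dominated (bound := fun s => C * Real.exp (-(1 / 6) * s ^ 2)) ?_ ?_
    ((integrable_exp_neg_mul_sq (by norm_num)).const_mul C) ?_
  · refine Eventually.of_forall fun z => Continuous.aestronglyMeasurable ?_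
    exact (differentiableOn_airyIntegrand k z).continuousOn.comp_continuous continuous_airyLine
      fun s => by simp [airyLine_re]
  · filter_upwards [(continuous_norm.tendsto z₀).eventually (ge_mem_nhds (lt_add_one _))] with z hz
    exact Eventually.of_forall (hC z hz)
  · refine Eventually.of_forall fun s => Continuous.continuousAt ?_
    unfold airyIntegrand
    fun_prop

theorem prefactor_eq (r : ℤ) {w : ℝ} (hw : 0 < w) :
    1 / √(2 * Real.pi * w) * (w ^ ((1 : ℝ) / 3) * 2 ^ ((1 : ℝ) / 3)) *
      (w ^ ((1 : ℝ) / 3) * 2 ^ ((1 : ℝ) / 3)) ^ r =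
    √(2 * Real.pi) / (2 * Real.pi) * 2 ^ (((r : ℝ) + 1) / 3) * w ^ ((r : ℝ) / 3 - 1 / 6) := by
  have h1 : √(2 * Real.pi * w) = √(2 * Real.pi) * w ^ ((1 : ℝ) / 2) := by
    rw [Real.sqrt_mul (by positivity), Real.sqrt_eq_rpow w]
  have h2 : (2 : ℝ) ^ (((r : ℝ) + 1) / 3) = (2 ^ ((1 : ℝ) / 3)) ^ r * 2 ^ ((1 : ℝ) / 3) := by
    rw [← Real.rpow_intCast, ← Real.rpow_mul two_pos.le, ← Real.rpow_add two_pos]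
    ring_nf
  have h3 : w ^ ((r : ℝ) / 3 - 1 / 6) * w ^ ((1 : ℝ) / 2) =
      (w ^ ((1 : ℝ) / 3)) ^ r * w ^ ((1 : ℝ) / 3) := by
    rw [← Real.rpow_intCast, ← Real.rpow_mul hw.le, ← Real.rpow_add hw, ← Real.rpow_add hw]
    ring_nf
  have h4 : √(2 * Real.pi) ^ 2 = 2 * Real.pi := Real.sq_sqrt (by positivity)
  have h5 : 0 < √(2 * Real.pi) := by positivity
  have h6 : 0 < w ^ ((1 : ℝ) / 2) := by positivity
  rw [h1, h2, mul_zpow]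
  generalize √(2 * Real.pi) = a at *
  generalize w ^ ((1 : ℝ) / 2) = b at *
  generalize w ^ ((r : ℝ) / 3 - 1 / 6) = c at *
  rw [← h4]
  field_simp
  linear_combination -h3

theorem rpow_one_third_pow_three {x : ℝ} (hx : 0 ≤ x) : (x ^ ((1 : ℝ) / 3)) ^ 3 = x := by
  rw [← Real.rpow_natCast, ← Real.rpow_mul hx]
  norm_num

theorem tendsto_rpow_one_third :
    Tendsto (fun w : ℝ => w ^ ((1 : ℝ) / 3)) (𝓝[>] 0) (𝓝[>] 0) := by
  refine tendsto_nhdsWithin_iff.2 ⟨?_, ?_⟩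
  · have := (Real.continuousAt_rpow_const (0 : ℝ) ((1 : ℝ) / 3) (Or.inr (by norm_num))).tendsto
    rw [Real.zero_rpow (by norm_num)] at this
    exact this.mono_left nhdsWithin_le_nhds
  · filter_upwards [self_mem_nhdsWithin] with w hw
    exact Real.rpow_pos_of_pos hw _

theorem exists_norm_one_sub_div_le {W : ℝ → ℝ}
    (hW : (fun w => W w - w) =O[𝓝[>] (0 : ℝ)] fun w => w ^ 2) (T : ℝ) :
    ∃ b : ℝ → ℝ, Tendsto b (𝓝[>] 0) (𝓝 0) ∧ ∀ᶠ w in 𝓝[>] (0 : ℝ), ∀ τ : ℂ, ‖τ‖ ≤ T →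
      ‖(1 - (1 - τ * ((w ^ ((1 : ℝ) / 3) : ℝ) : ℂ) ^ 2) * W w / ((w ^ ((1 : ℝ) / 3) : ℝ) : ℂ) ^ 3) /
        ((w ^ ((1 : ℝ) / 3) : ℝ) : ℂ)‖ ≤ b w := by
  obtain ⟨C, hC⟩ := hW.bound
  refine ⟨fun w => C * (w ^ ((1 : ℝ) / 3)) ^ 2 +
    T * (w ^ ((1 : ℝ) / 3)) * (1 + C * (w ^ ((1 : ℝ) / 3)) ^ 3), ?_, ?_⟩
  · have hh : Tendsto (fun w : ℝ => w ^ ((1 : ℝ) / 3)) (𝓝[>] 0) (𝓝 0) :=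
      tendsto_rpow_one_third.mono_right nhdsWithin_le_nhds
    simpa using ((hh.pow 2).const_mul C).add
      ((hh.const_mul T).mul (((hh.pow 3).const_mul C).const_add 1))
  · filter_upwards [hC, self_mem_nhdsWithin] with w hw hw0 τ hτ
    have hw0' : 0 < w := hw0
    have hpos : 0 < w ^ ((1 : ℝ) / 3) := Real.rpow_pos_of_pos hw0 _
    have hcube := rpow_one_third_pow_three hw0'.le
    rw [Real.norm_eq_abs, Real.norm_eq_abs, abs_of_nonneg (sq_nonneg w)] at hw
    generalize w ^ ((1 : ℝ) / 3) = h at *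
    subst hcube
    set V := W (h ^ 3)
    have hT : 0 ≤ T := (norm_nonneg _).trans hτ
    have hne : (h : ℂ) ≠ 0 := Complex.ofReal_ne_zero.2 hpos.ne'
    have hg : |(V - h ^ 3) / h ^ 3| ≤ C * h ^ 3 := by
      rw [abs_div, abs_of_pos hw0', div_le_iff₀ hw0']
      linarith
    set g := (V - h ^ 3) / h ^ 3 with hgdef
    have hV : V = h ^ 3 * (1 + g) := by rw [hgdef]; field_simp; ring
    have heq : (1 - (1 - τ * (h : ℂ) ^ 2) * V / (h : ℂ) ^ 3) / h =
        -((g / h : ℝ) : ℂ) + τ * h * (1 + g : ℝ) := by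
      rw [hV]
      push_cast
      field_simp
      ring
    rw [heq]
    refine (norm_add_le _ _).trans ?_
    rw [norm_neg, norm_mul, norm_mul, Complex.norm_real, Complex.norm_real, Complex.norm_real,
      Real.norm_eq_abs, Real.norm_eq_abs, Real.norm_eq_abs, abs_of_pos hpos, abs_div,
      abs_of_pos hpos]
    have h1 : |g| / h ≤ C * h ^ 2 := by
      rw [div_le_iff₀ hpos]
      linarith
    have h2 : |1 + g| ≤ 1 + C * h ^ 3 := by
      refine (abs_add_le _ _).trans ?_
      rw [abs_one]
      linarith
    gcongr

/-- Part (c) of the analytic lemma, uniformly on compact `τ`-sets: with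
`z(τ,w) = (1 − τw^{2/3})/(ew)`,
`φ_r = (−1)^r √(2π) 2^{(r+1)/3} w^{r/3−1/6} (Ai(r; 2^{1/3}τ)F(1) + η(τ,w))
e^{−1/(2w) + τ/w^{1/3}}` where `η → 0` uniformly on `S` as `w → 0⁺`. -/
theorem phiR_uniform_part_c (r : ℤ) (F : ℂ → ℂ) (hF : Differentiable ℂ F)
    (hFne : ∀ x : ℂ, x ≠ 0 → F x ≠ 0)
    (W : ℝ → ℝ) (hW : (fun w => W w - w) =O[𝓝[>] (0 : ℝ)] fun w => w ^ 2)
    (S : Set ℂ) (hS : IsCompact S) :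
    ∃ η : ℂ → ℝ → ℂ,
      (∀ᶠ w in 𝓝[>] (0 : ℝ), ∀ τ ∈ S,
        phiR r ((1 - τ * ((w ^ ((2 : ℝ) / 3) : ℝ) : ℂ)) / ((Real.exp 1 * w : ℝ) : ℂ))
            w (W w) F =
          (-1 : ℂ) ^ r * (Real.sqrt (2 * Real.pi) : ℂ) *
            (((2 : ℝ) ^ (((r : ℝ) + 1) / 3) : ℝ) : ℂ) *
            ((w ^ ((r : ℝ) / 3 - 1 / 6) : ℝ) : ℂ) *
            (genAiry r ((2 : ℂ) ^ ((1 : ℂ) / 3) * τ) * F 1 + η τ w) *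
            Complex.exp (-1 / (2 * (w : ℂ)) + τ / ((w ^ ((1 : ℝ) / 3) : ℝ) : ℂ))) ∧
      TendstoUniformlyOn (fun w τ => η τ w) 0 (𝓝[>] (0 : ℝ)) S := by
  set β : ℝ := 2 ^ ((1 : ℝ) / 3) with hβdef
  have hβ : 0 < β := by positivity
  have hβ3 : β ^ 3 = 2 := rpow_one_third_pow_three two_pos.le
  have hβc : (2 : ℂ) ^ ((1 : ℂ) / 3) = (β : ℂ) := by
    rw [hβdef, Complex.ofReal_cpow two_pos.le]
    norm_num
  set κ : ℝ → ℂ → ℂ := fun w τ => (1 - τ * ((w ^ ((1 : ℝ) / 3) : ℝ) : ℂ) ^ 2) * W w /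
    ((w ^ ((1 : ℝ) / 3) : ℝ) : ℂ) ^ 3
  obtain ⟨T, hT⟩ := hS.isBounded.exists_norm_le
  obtain ⟨b, hb0, hb⟩ := exists_norm_one_sub_div_le hW T
  refine ⟨fun τ w => (-1 : ℂ) ^ r * ((√3 / 2 : ℝ) : ℂ) / (2 * (Real.pi : ℂ)) *
    ((∫ s : ℝ, scaledIntegrand r F β (w ^ ((1 : ℝ) / 3)) (κ w τ) τ s) -
      (∫ s : ℝ, airyIntegrand r (β * τ) (airyLine s)) * F 1), ?_, ?_⟩
  · have hsmall : ∀ᶠ w in 𝓝[>] (0 : ℝ), w ^ ((1 : ℝ) / 3) * β ≤ 2 := by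
      have := (tendsto_rpow_one_third.mono_right nhdsWithin_le_nhds).mul_const β
      rw [zero_mul] at this
      exact this.eventually (ge_mem_nhds two_pos)
    filter_upwards [hb, hsmall, hb0.eventually (gt_mem_nhds (by positivity : 0 < β / 4)),
      self_mem_nhdsWithin] with w hbw hw2 hbβ hw τ hτ
    have hw0 : 0 < w := hw
    have hpos : 0 < w ^ ((1 : ℝ) / 3) := Real.rpow_pos_of_pos hw0 _
    have hcube := rpow_one_third_pow_three hw0.le
    have hsq : w ^ ((2 : ℝ) / 3) = (w ^ ((1 : ℝ) / 3)) ^ 2 := by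
      rw [← Real.rpow_natCast, ← Real.rpow_mul hw0.le]
      norm_num
    have hκn : ‖κ w τ‖ < Real.exp (w ^ ((1 : ℝ) / 3) * β / 4) := by
      have h1 := (hbw τ (hT τ hτ)).trans_lt hbβ
      rw [norm_div, Complex.norm_real, Real.norm_eq_abs, abs_of_pos hpos, div_lt_iff₀ hpos] at h1
      have h2 := norm_sub_norm_le (κ w τ) 1
      rw [norm_sub_rev, norm_one] at h2
      have h3 := Real.add_one_le_exp (w ^ ((1 : ℝ) / 3) * β / 4)
      linarith
    have key := phiR_eq_integral_scaledIntegrand r hF hβ hpos hw2 (κ w τ) τ (wp := W w) rfl hκn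
    have hpre := congrArg (fun x : ℝ => (x : ℂ)) (prefactor_eq r hw0)
    have hsign : (-1 : ℂ) ^ r * (-1 : ℂ) ^ r = 1 := by
      rw [← mul_zpow]
      simp
    have hcubec : ((w ^ ((1 : ℝ) / 3) : ℝ) : ℂ) ^ 3 = w := by exact_mod_cast hcube
    rw [hcube, hcubec] at key
    rw [hsq, Complex.ofReal_pow, key, genAiry_eq_integral_airyLine, hβc]
    push_cast at hpre ⊢
    rw [← hβdef] at hpre
    generalize (-1 : ℂ) ^ r = σ at *
    generalize (((w ^ ((1 : ℝ) / 3) : ℝ) : ℂ) * β) ^ r = P at *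
    generalize Complex.exp _ = E
    generalize (∫ s : ℝ, scaledIntegrand r F β _ (κ w τ) τ s) = J
    linear_combination (((√3 : ℝ) : ℂ) / 2 * E * J) * hpre -
      ((√(2 * Real.pi) : ℝ) : ℂ) / (2 * (Real.pi : ℂ)) * (((2 : ℝ) ^ (((r : ℝ) + 1) / 3) : ℝ) : ℂ) *
        ((w ^ ((r : ℝ) / 3 - 1 / 6) : ℝ) : ℂ) * (((√3 : ℝ) : ℂ) / 2 * E * J) * hsign
  · rw [← tendstoLocallyUniformlyOn_iff_tendstoUniformlyOn_of_compact hS,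
      tendstoLocallyUniformlyOn_iff_filter]
    intro τ₀ hτ₀
    rw [Metric.tendstoUniformlyOnFilter_iff]
    have hτ : Tendsto (fun q : ℝ × ℂ => q.2) (𝓝[>] (0 : ℝ) ×ˢ 𝓝[S] τ₀) (𝓝 τ₀) :=
      tendsto_snd.mono_right nhdsWithin_le_nhds
    have hh : Tendsto (fun q : ℝ × ℂ => q.1 ^ ((1 : ℝ) / 3)) (𝓝[>] (0 : ℝ) ×ˢ 𝓝[S] τ₀) (𝓝[>] 0) :=
      tendsto_rpow_one_third.comp tendsto_fst
    have hκ : Tendsto (fun q : ℝ × ℂ => (1 - κ q.1 q.2) / ((q.1 ^ ((1 : ℝ) / 3) : ℝ) : ℂ))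
        (𝓝[>] (0 : ℝ) ×ˢ 𝓝[S] τ₀) (𝓝 0) := by
      refine squeeze_zero_norm' ?_ (hb0.comp tendsto_fst)
      filter_upwards [tendsto_fst.eventually hb, tendsto_snd.eventually self_mem_nhdsWithin]
        with q h1 h2
      exact h1 q.2 (hT q.2 h2)
    have h1 := tendsto_integral_scaledIntegrand r hF.continuous hβ hβ3 hh hκ hτ
    have h2 : Tendsto (fun q : ℝ × ℂ => ∫ s : ℝ, airyIntegrand r (β * q.2) (airyLine s))
        (𝓝[>] (0 : ℝ) ×ˢ 𝓝[S] τ₀) (𝓝 (∫ s : ℝ, airyIntegrand r (β * τ₀) (airyLine s))) :=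
      ((continuous_integral_airyIntegrand r).tendsto (β * τ₀)).comp (hτ.const_mul (β : ℂ))
    have h3 := (h1.sub (h2.mul_const (F 1))).const_mul
      ((-1 : ℂ) ^ r * ((√3 / 2 : ℝ) : ℂ) / (2 * (Real.pi : ℂ)))
    rw [sub_self, mul_zero] at h3
    intro ε hε
    filter_upwards [Metric.tendsto_nhds.1 h3 ε hε] with q hq
    rw [dist_comm]
    exact hq
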